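/- Let c ≥ 2, let p be a monotone probability vector on c classes, and let S be a finite multiset of class labels from {1,…,c}. Let m be a class of maximal multiplicity in S and let S_support be S with all copies of m removed. Let 0 < α ≤ 1 be real. If |S_support| ≥ ⌈log₂(1/α)⌉, then ∏_{y ∈ S} p_y ≤ α. -/

import Mathlib

theorem Multiset.count_add_card_filter_ne {ι : Type*} [DecidableEq ι] (S : Multiset ι) (a : ι) :
    S.count a + card (S.filter (· ≠ a)) = card S := by
  rw [count_eq_card_filter_eq, ← card_add]
  simp only [eq_comm (a := a)]
  exact congrArg card (S.filter_add_not (· = a))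

/-- If every factor is at most `1`, and every factor away from the index `a` is at most `r`, then
the product is at most `r` to the number of indices different from `a`. -/
theorem Multiset.prod_map_le_pow_card_filter_ne {ι : Type*} [DecidableEq ι] {p : ι → ℝ} {r : ℝ}
    (a : ι) (S : Multiset ι) (h_nonneg : ∀ y ∈ S, 0 ≤ p y) (h_one : ∀ y ∈ S, p y ≤ 1)
    (h_le : ∀ y ∈ S, y ≠ a → p y ≤ r) :
    (S.map p).prod ≤ r ^ card (S.filter (· ≠ a)) := by
  induction S using Multiset.induction with
  | empty => simp
  | cons y S ih =>
    have ih' := ih (fun z hz => h_nonneg z (mem_cons_of_mem hz))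
      (fun z hz => h_one z (mem_cons_of_mem hz)) (fun z hz => h_le z (mem_cons_of_mem hz))
    have hprod : 0 ≤ (S.map p).prod := prod_nonneg fun x hx => by
      obtain ⟨z, hz, rfl⟩ := mem_map.1 hx
      exact h_nonneg z (mem_cons_of_mem hz)
    have hy := mem_cons_self y S
    rw [map_cons, prod_cons]
    by_cases hya : y = a
    · rw [filter_cons_of_neg (p := (· ≠ a)) S (not_not.2 hya)]
      exact (mul_le_of_le_one_left hprod (h_one y hy)).trans ih'
    · rw [filter_cons_of_pos (p := (· ≠ a)) S hya, card_cons, pow_succ']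
      exact mul_le_mul (h_le y hy hya) ih' hprod ((h_nonneg y hy).trans (h_le y hy hya))

/-- Theorem 1 of the paper: For a monotone probability vector `p`
on `c ≥ 2` classes, a finite multiset `S` of class labels from `{1, …, c}`, a
class `m` of maximal multiplicity in `S`, the supporting set `S_support`
(i.e. `S` with all copies of `m` removed), and a real `0 < α ≤ 1`: if
`|S_support| ≥ ⌈log₂ (1/α)⌉`, then `∏_{y ∈ S} p y ≤ α`. -/
theorem supporting_set_rejects_null (c : ℕ) (hc : 2 ≤ c) (p : ℕ → ℝ)
    (h1 : p 1 ≤ 1)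
    (hmono : ∀ i j : ℕ, 1 ≤ i → i ≤ j → j ≤ c → p j ≤ p i)
    (hlast : 0 ≤ p c)
    (hsum : ∑ i ∈ Finset.Icc 1 c, p i = 1)
    (S : Multiset ℕ) (hS : ∀ y ∈ S, 1 ≤ y ∧ y ≤ c)
    (m : ℕ) (hm : 1 ≤ m ∧ m ≤ c)
    (hmmax : ∀ y : ℕ, 1 ≤ y → y ≤ c → S.count y ≤ S.count m)
    (Ssupport : Multiset ℕ) (hsupp : Ssupport = S.filter (· ≠ m))
    (α : ℝ) (hα0 : 0 < α) (hα1 : α ≤ 1)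
    (hcard : ⌈Real.logb 2 (1 / α)⌉ ≤ (Multiset.card Ssupport : ℤ)) :
    (S.map p).prod ≤ α := by
  subst hsupp
  have h_nonneg : ∀ y ∈ S, 0 ≤ p y := fun y hy =>
    hlast.trans (hmono y c (hS y hy).1 (hS y hy).2 le_rfl)
  have h_one : ∀ y ∈ S, p y ≤ 1 := fun y hy =>
    (hmono 1 y le_rfl (hS y hy).1 (hS y hy).2).trans h1
  have h_half : ∀ y ∈ S, y ≠ 1 → p y ≤ 1 / 2 := by
    intro y hy hy1
    obtain ⟨hy_pos, hyc⟩ := hS y hy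
    have hpair : p 1 + p y ≤ 1 := by
      rw [← hsum, ← Finset.sum_pair hy1.symm]
      refine Finset.sum_le_sum_of_subset_of_nonneg ?_ fun i hi _ => ?_
      · intro i hi
        simp only [Finset.mem_insert, Finset.mem_singleton] at hi
        rw [Finset.mem_Icc]
        omega
      · rw [Finset.mem_Icc] at hi
        exact hlast.trans (hmono i c hi.1 hi.2 le_rfl)
    linarith [hmono 1 y le_rfl hy_pos hyc]
  have hcard_le : Multiset.card (S.filter (· ≠ m)) ≤ Multiset.card (S.filter (· ≠ 1)) := by
    have := hmmax 1 le_rfl (by omega)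
    have := S.count_add_card_filter_ne m
    have := S.count_add_card_filter_ne 1
    omega
  have hpow : 1 / α ≤ 2 ^ Multiset.card (S.filter (· ≠ m)) := by
    rw [Int.ceil_le, Real.logb_le_iff_le_rpow one_lt_two (by positivity)] at hcard
    exact_mod_cast hcard
  calc (S.map p).prod
      ≤ (1 / 2) ^ Multiset.card (S.filter (· ≠ 1)) :=
        S.prod_map_le_pow_card_filter_ne 1 h_nonneg h_one h_half
    _ ≤ (1 / 2) ^ Multiset.card (S.filter (· ≠ m)) :=
        pow_le_pow_of_le_one (by norm_num) (by norm_num) hcard_le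
    _ ≤ α := by
        rw [one_div_pow]
        exact (one_div_le hα0 (by positivity)).1 hpow
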